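/- Let T be a two-branch tree with order p and diameter d ≥ 2, let f be a radio labelling of T, and let u_0, u_1, ..., u_{p-1} be the induced linear order of V(T). Let i and j be integers with 0 < i ≤ j < p-1 such that (a) u_t ∉ W(T) for i ≤ t ≤ j, and {u_{i-1}, u_i, u_j, u_{j+1}} ∩ S(T) = {u_i, u_j}; and (b) for i-1 ≤ t ≤ j, the vertices u_t and u_{t+1} are in different branches when |W(T)| = 1 and in opposite branches when |W(T)| = 2. Then J_f(u_{i-1}, ..., u_{j+1}) ≥ (|{u_i, ..., u_j} ∩ S(T)| - |{u_{i-1}, u_{j+1}} ∩ W(T)|) / (3 - |W(T)|). -/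

import Mathlib

open SimpleGraph Finset

open scoped Classical

namespace RadioPaper

variable {V : Type*} [Fintype V] [DecidableEq V]

/-- The diameter of a graph: the maximum distance between two vertices. -/
noncomputable def gdiam (G : SimpleGraph V) : ℕ :=
  Finset.univ.sup fun pr : V × V => G.dist pr.1 pr.2

/-- A radio labelling of `G`: `|f u - f v| ≥ diam G + 1 - d(u,v)` for distinct `u, v`. -/
def IsRadioLabelling (G : SimpleGraph V) (f : V → ℕ) : Prop :=
  ∀ u v : V, u ≠ v → (gdiam G : ℤ) + 1 - (G.dist u v : ℤ) ≤ |(f u : ℤ) - (f v : ℤ)|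

/-- The span of a labelling: the maximum difference between two labels. -/
noncomputable def span (f : V → ℕ) : ℕ :=
  Finset.univ.sup fun pr : V × V => f pr.1 - f pr.2

/-- The radio number of `G`: the minimum span of a radio labelling. -/
noncomputable def radioNumber (G : SimpleGraph V) : ℕ :=
  sInf {s | ∃ f : V → ℕ, IsRadioLabelling G f ∧ span f = s}

/-- The weight of `G` from `v`. -/
noncomputable def weight (G : SimpleGraph V) (v : V) : ℕ := ∑ u : V, G.dist u v

/-- The set of weight centers: vertices of minimum weight. -/
noncomputable def wcenters (G : SimpleGraph V) : Finset V :=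
  Finset.univ.filter fun v => ∀ u : V, weight G v ≤ weight G u

/-- `ε(T) = 2 - |W(T)|`. -/
noncomputable def eps (G : SimpleGraph V) : ℕ := 2 - (wcenters G).card

/-- The level of a vertex: its minimum distance to a weight center. -/
noncomputable def level (G : SimpleGraph V) (u : V) : ℕ :=
  sInf {n | ∃ x ∈ wcenters G, G.dist u x = n}

/-- The total level of `G`. -/
noncomputable def totalLevel (G : SimpleGraph V) : ℕ := ∑ u : V, level G u

/-- `T` is a two-branch tree: removing the weight centers leaves exactly two components. -/
def TwoBranch (G : SimpleGraph V) : Prop :=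
  Nat.card (SimpleGraph.induce {v : V | v ∉ wcenters G} G).ConnectedComponent = 2

/-- The set of remote vertices `S(T)`. -/
noncomputable def remote (G : SimpleGraph V) : Finset V :=
  if (wcenters G).card = 1 then Finset.univ.filter fun u => (gdiam G + 1) / 2 ≤ level G u
  else Finset.univ.filter fun u => gdiam G / 2 ≤ level G u

/-- `ξ(T)`. -/
noncomputable def xi (G : SimpleGraph V) : ℕ :=
  if (wcenters G).card = 1 then (remote G).card / 2 else (remote G).card - 2

/-- `u` and `v` lie in different branches: the path between them traverses exactly one
weight center. -/
def DiffBranches (G : SimpleGraph V) (u v : V) : Prop :=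
  ∀ p : G.Path u v, (p.1.support.filter fun x => decide (x ∈ wcenters G)).length = 1

/-- `u` and `v` lie in opposite branches: the path between them traverses two weight centers. -/
def OppBranches (G : SimpleGraph V) (u v : V) : Prop :=
  ∀ p : G.Path u v, (p.1.support.filter fun x => decide (x ∈ wcenters G)).length = 2

/-- `u` and `v` lie in the same branch of `T - W(T)`. -/
def SameBranch (G : SimpleGraph V) (u v : V) : Prop :=
  ∃ (hu : u ∉ wcenters G) (hv : v ∉ wcenters G),
    (SimpleGraph.induce {x : V | x ∉ wcenters G} G).Reachable ⟨u, hu⟩ ⟨v, hv⟩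

/-- `x` is an ancestor of `v`: `x` lies on the path joining a weight center and `v`. -/
def IsAncestor (G : SimpleGraph V) (x v : V) : Prop :=
  ∃ w ∈ wcenters G, ∀ p : G.Path w v, x ∈ p.1.support

/-- `φ(u,v)`: the maximum level of a common ancestor of `u` and `v`. -/
noncomputable def phi (G : SimpleGraph V) (u v : V) : ℕ :=
  sSup {n | ∃ x : V, IsAncestor G x u ∧ IsAncestor G x v ∧ level G x = n}

/-- `δ(u,v)`. -/
noncomputable def deltaWC (G : SimpleGraph V) (u v : V) : ℕ :=
  if (wcenters G).card = 2 ∧ ∀ p : G.Path u v, ∀ w ∈ wcenters G, w ∈ p.1.support then 1 else 0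

/-- `u` enumerates the vertices of `G` in strictly increasing order of labels under `f`. -/
def IsInducedOrder (G : SimpleGraph V) (f : V → ℕ) (u : ℕ → V) : Prop :=
  (∀ v : V, ∃! i : ℕ, i < Fintype.card V ∧ u i = v) ∧
  ∀ i j : ℕ, i < j → j < Fintype.card V → f (u i) < f (u j)

/-- `J_f(u_t, u_{t+1})`. -/
noncomputable def Jstep (G : SimpleGraph V) (f : V → ℕ) (u : ℕ → V) (t : ℕ) : ℤ :=
  ((f (u (t+1)) : ℤ) - (f (u t) : ℤ)) + (G.dist (u t) (u (t+1)) : ℤ) - ((gdiam G : ℤ) + 1)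

/-- `J_f(u_i, …, u_j)`. -/
noncomputable def Jseg (G : SimpleGraph V) (f : V → ℕ) (u : ℕ → V) (i j : ℕ) : ℤ :=
  ∑ t ∈ Finset.Ico i j, Jstep G f u t

/-- `σ(f)`. -/
noncomputable def sigmaF (G : SimpleGraph V) (f : V → ℕ) (u : ℕ → V) : ℤ :=
  ∑ t ∈ Finset.range (Fintype.card V - 1),
    (Jstep G f u t + 2 * (phi G (u t) (u (t+1)) : ℤ) - (deltaWC G (u t) (u (t+1)) : ℤ))

/-- Consecutive vertices in the order are in different branches when `|W(T)| = 1`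
and in opposite branches when `|W(T)| = 2`. -/
def BranchStep (G : SimpleGraph V) (u v : V) : Prop :=
  ((wcenters G).card = 1 → DiffBranches G u v) ∧
  ((wcenters G).card = 2 → OppBranches G u v)

/-- `f ∈ F`: every pair of consecutive vertices of the induced order is in different
branches when `|W(T)| = 1` and in opposite branches when `|W(T)| = 2`. -/
def MemF (G : SimpleGraph V) (f : V → ℕ) (u : ℕ → V) : Prop :=
  ∀ i : ℕ, i + 1 < Fintype.card V → BranchStep G (u i) (u (i+1))

/-- `u_i, u_{i+1}` is a bad pair. -/
def BadPair (G : SimpleGraph V) (u : ℕ → V) (i : ℕ) : Prop :=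
  i + 1 < Fintype.card V ∧ u i ∉ wcenters G ∧ u (i+1) ∉ wcenters G ∧
    SameBranch G (u i) (u (i+1))

/-- `X_f`: the set of vertices in at least one bad pair. -/
noncomputable def Xf (G : SimpleGraph V) (u : ℕ → V) : Finset V :=
  Finset.univ.filter fun v => ∃ i : ℕ, BadPair G u i ∧ (v = u i ∨ v = u (i+1))

/-- `[i, j]` is a maximal run of positions (within `[0, p-1]`) satisfying `P`. -/
def IsMaxRun (p : ℕ) (P : ℕ → Prop) (i j : ℕ) : Prop :=
  i ≤ j ∧ j < p ∧ (∀ t, i ≤ t → t ≤ j → P t) ∧ (i = 0 ∨ ¬P (i - 1)) ∧ (j = p - 1 ∨ ¬P (j + 1))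

/-- The number of maximal runs of `P` having odd length. -/
noncomputable def oddRunCount (p : ℕ) (P : ℕ → Prop) : ℕ :=
  ((Finset.range p ×ˢ Finset.range p).filter fun ij : ℕ × ℕ =>
    IsMaxRun p P ij.1 ij.2 ∧ Odd (ij.2 - ij.1 + 1)).card

/-- The linear order `u` is feasible. -/
def Feasible (G : SimpleGraph V) (u : ℕ → V) : Prop :=
  (Even (remote G).card →
    oddRunCount (Fintype.card V) (fun t => u t ∈ remote G) = 0) ∧
  (Odd (remote G).card →
    oddRunCount (Fintype.card V) (fun t => u t ∈ remote G) ≤ 1)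

/-- Position `t` is immediately before or after a weight center in the order `u`. -/
def NearWC (G : SimpleGraph V) (u : ℕ → V) (t : ℕ) : Prop :=
  (t + 1 < Fintype.card V ∧ u (t+1) ∈ wcenters G) ∨ (1 ≤ t ∧ u (t-1) ∈ wcenters G)

/-- Position `t` holds a remote vertex not immediately before or after a weight center. -/
def RemainingRemote (G : SimpleGraph V) (u : ℕ → V) (t : ℕ) : Prop :=
  t < Fintype.card V ∧ u t ∈ remote G ∧ ¬NearWC G u t

/-- The linear order `u` is admissible. -/
def Admissible (G : SimpleGraph V) (u : ℕ → V) : Prop :=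
  (∀ t : ℕ, t < Fintype.card V → u t ∈ wcenters G →
    (1 ≤ t → u (t-1) ∈ remote G) ∧ (t + 1 < Fintype.card V → u (t+1) ∈ remote G)) ∧
  (Even ((Finset.range (Fintype.card V)).filter fun t => RemainingRemote G u t).card →
    oddRunCount (Fintype.card V) (RemainingRemote G u) = 0) ∧
  (Odd ((Finset.range (Fintype.card V)).filter fun t => RemainingRemote G u t).card →
    oddRunCount (Fintype.card V) (RemainingRemote G u) ≤ 1)

/-- Condition (a) of Theorem `thm:lower` on the linear order `u`. -/
def OrderCondA (G : SimpleGraph V) (u : ℕ → V) : Prop :=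
  ((wcenters G).card = 1 →
    (Odd (remote G).card →
      level G (u 0) + level G (u (Fintype.card V - 1)) = 1 ∧ Admissible G u) ∧
    (Even (remote G).card →
      (level G (u 0) + level G (u (Fintype.card V - 1)) = 1 ∧
        (Feasible G u ∨ Admissible G u)) ∨
      (level G (u 0) + level G (u (Fintype.card V - 1)) = 2 ∧ Admissible G u))) ∧
  ((wcenters G).card = 2 →
    Admissible G u ∧
    ((remote G).card = 1 ∨ (remote G).card = 2 →
      level G (u 0) + level G (u (Fintype.card V - 1)) = 0) ∧
    (3 ≤ (remote G).card → Odd (remote G).card →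
      level G (u 0) + level G (u (Fintype.card V - 1)) = 1) ∧
    (4 ≤ (remote G).card → Even (remote G).card →
      level G (u 0) + level G (u (Fintype.card V - 1)) = 0 ∨
      level G (u 0) + level G (u (Fintype.card V - 1)) = 2))

/-- Condition (b) of Theorem `thm:lower`: the distance inequality. -/
def OrderCondB (G : SimpleGraph V) (u : ℕ → V) (a : ℕ → ℕ) : Prop :=
  ∀ i j : ℕ, i < j → j ≤ Fintype.card V - 1 →
    (∑ t ∈ Finset.Ico i j,
      ((level G (u t) : ℤ) + (level G (u (t+1)) : ℤ) - (a t : ℤ)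
        - ((gdiam G : ℤ) + (eps G : ℤ))))
      + ((gdiam G : ℤ) + 1) ≤ (G.dist (u i) (u j) : ℤ)

/-- The sequence `a_0, …, a_{p-2}` determined by the order `u` via `(eq:a0)`–`(eq:seq)`. -/
def SeqA (G : SimpleGraph V) (u : ℕ → V) (a : ℕ → ℕ) : Prop :=
  a 0 = 0 ∧
  ∀ t : ℕ, 1 ≤ t → t ≤ Fintype.card V - 2 →
    a (t-1) + a t =
      if u t ∈ remote G ∧ u (t-1) ∉ wcenters G ∧ u (t+1) ∉ wcenters G
      then (wcenters G).card else 0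

/-- The spine index set of the caterpillar `C(n,k)`. -/
def spineSet (n : ℕ) : Finset ℕ :=
  if n % 2 = 1 then {1, (n-1)/2, (n+3)/2, n} else {1, (n-2)/2, (n+4)/2, n}

/-- `G` is (isomorphic to) the caterpillar `C(n,k)`. -/
def IsCaterpillarC (G : SimpleGraph V) (n k : ℕ) : Prop :=
  G.IsTree ∧
  ∃ v : ℕ → V,
    (∀ i j : ℕ, 1 ≤ i → i ≤ n → 1 ≤ j → j ≤ n → v i = v j → i = j) ∧
    (∀ i : ℕ, 1 ≤ i → i < n → G.Adj (v i) (v (i+1))) ∧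
    (∀ x : V, (∃ i : ℕ, 1 ≤ i ∧ i ≤ n ∧ v i = x) ∨ (G.neighborSet x).ncard = 1) ∧
    (∀ i : ℕ, 1 ≤ i → i ≤ n →
      {x ∈ G.neighborSet (v i) | (G.neighborSet x).ncard = 1}.ncard =
        if i ∈ spineSet n then k else 0)

/-- `G` is (isomorphic to) the level-wise regular tree `T^z_{m_0, …, m_{h-1}}`:
a tree with a center `C` of `z` vertices (adjacent when `z = 2`), height `h`,
in which every vertex at distance `i < h` from `C` has degree `m i` and every
vertex at distance `h` from `C` is a leaf. -/
def IsLevelwiseRegular (G : SimpleGraph V) (z h : ℕ) (m : ℕ → ℕ) : Prop :=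
  G.IsTree ∧
  ∃ (C : Finset V) (dC : V → ℕ),
    C.card = z ∧
    (∀ c ∈ C, ∀ c' ∈ C, c ≠ c' → G.Adj c c') ∧
    (∀ x : V, IsLeast {n | ∃ c ∈ C, G.dist x c = n} (dC x)) ∧
    (∀ x : V, dC x ≤ h) ∧
    (∀ x : V, dC x = h → (G.neighborSet x).ncard = 1) ∧
    (∀ x : V, dC x < h → (G.neighborSet x).ncard = m (dC x))

/-- In a tree, every path realises the distance between its endpoints. -/
lemma length_eq_dist_of_isPath {V : Type*} {G : SimpleGraph V} (hT : G.IsTree) {a b : V}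
    {p : G.Walk a b} (hp : p.IsPath) : p.length = G.dist a b := by
  obtain ⟨q, hq⟩ := hT.connected.exists_walk_length_eq_dist a b
  rw [(hT.existsUnique_path a b).unique hp (q.isPath_of_length_eq_dist hq), hq]

lemma dist_add_dist_of_mem_support {V : Type*} [DecidableEq V] {G : SimpleGraph V}
    (hT : G.IsTree) {a b c : V} {p : G.Walk a b} (hp : p.IsPath) (hc : c ∈ p.support) :
    G.dist a c + G.dist c b = G.dist a b := by
  rw [← length_eq_dist_of_isPath hT hp, ← length_eq_dist_of_isPath hT (hp.takeUntil hc),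
    ← length_eq_dist_of_isPath hT (hp.dropUntil hc), ← Walk.length_append, Walk.take_spec]

/-- Concatenating two paths that meet only at the junction gives a path. -/
lemma isPath_append {V : Type*} {G : SimpleGraph V} {m c a : V}
    {r : G.Walk m c} {s : G.Walk c a} (hr : r.IsPath) (hs : s.IsPath)
    (h : ∀ x ∈ r.support, x ∈ s.support → x = c) : (r.append s).IsPath := by
  rw [Walk.isPath_def, Walk.support_append]
  have hs' := hs.support_nodup
  rw [← Walk.cons_tail_support] at hs'
  rw [List.nodup_append']
  refine ⟨hr.support_nodup, (List.nodup_cons.1 hs').2, fun x hx hx' => ?_⟩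
  obtain rfl := h x hx (List.mem_of_mem_tail hx')
  exact (List.nodup_cons.1 hs').1 hx'

/-- Projection of a vertex `m` of a tree onto a path `p`. -/
lemma exists_projection {V : Type*} [DecidableEq V] {G : SimpleGraph V}
    (hT : G.IsTree) (m : V) {a b : V} {p : G.Walk a b} (hp : p.IsPath) :
    ∃ (c : V) (hc : c ∈ p.support) (r : G.Walk m c), r.IsPath ∧
      (r.append (p.takeUntil c hc).reverse).IsPath ∧ (r.append (p.dropUntil c hc)).IsPath := by
  obtain ⟨c, hc, hmin⟩ := p.support.toFinset.exists_min_image (G.dist m)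
    ⟨a, by simp⟩
  rw [List.mem_toFinset] at hc
  obtain ⟨r, hr⟩ := hT.connected.exists_isPath m c
  have key : ∀ x ∈ r.support, x ∈ p.support → x = c := fun x hx hxp => by
    have h1 := dist_add_dist_of_mem_support hT hr hx
    have h2 := hmin x (List.mem_toFinset.2 hxp)
    exact hT.connected.dist_eq_zero_iff.1 (by omega)
  refine ⟨c, hc, r, hr, isPath_append hr (hp.takeUntil hc).reverse fun x hx hx' => ?_,
    isPath_append hr (hp.dropUntil hc) fun x hx hx' => ?_⟩
  · rw [Walk.support_reverse, List.mem_reverse] at hx'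
    exact key x hx (Walk.support_takeUntil_subset_support _ hc hx')
  · exact key x hx (Walk.support_dropUntil_subset_support _ hc hx')

lemma exists_median {V : Type*} [DecidableEq V] {G : SimpleGraph V}
    (hT : G.IsTree) (m : V) {a b : V} {p : G.Walk a b} (hp : p.IsPath) :
    ∃ c ∈ p.support, G.dist m a = G.dist m c + G.dist a c ∧
      G.dist m b = G.dist m c + G.dist c b ∧ G.dist a b = G.dist a c + G.dist c b := by
  obtain ⟨c, hc, r, hr, h1, h2⟩ := exists_projection hT m hp
  refine ⟨c, hc, ?_, ?_, (dist_add_dist_of_mem_support hT hp hc).symm⟩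
  · rw [← length_eq_dist_of_isPath hT h1, ← length_eq_dist_of_isPath hT hr,
      ← length_eq_dist_of_isPath hT (hp.takeUntil hc), Walk.length_append, Walk.length_reverse]
  · rw [← length_eq_dist_of_isPath hT h2, ← length_eq_dist_of_isPath hT hr,
      ← length_eq_dist_of_isPath hT (hp.dropUntil hc), Walk.length_append]

/-- Two weight centers of a tree are adjacent. -/
lemma dist_le_one_of_mem_wcenters {G : SimpleGraph V}
    (hT : G.IsTree) {a b : V} (ha : a ∈ wcenters G) (hb : b ∈ wcenters G) :
    G.dist a b ≤ 1 := by
  by_contra! hlt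
  obtain ⟨p, hp⟩ := hT.connected.exists_isPath a b
  cases p with
  | nil => simp at hlt
  | @cons _ x _ hax q =>
    have hq := hp.of_cons
    have hdax : G.dist a x = 1 := dist_eq_one_iff_adj.2 hax
    have hn : G.dist a b = G.dist x b + 1 := by
      rw [← length_eq_dist_of_isPath hT hp, ← length_eq_dist_of_isPath hT hq, Walk.length_cons]
    obtain ⟨n, hn'⟩ : ∃ n, G.dist a b = n + 2 := ⟨G.dist a b - 2, by omega⟩
    have conv : ∀ y, (n + 2) * G.dist y x ≤ (n + 1) * G.dist y a + G.dist y b := fun y => by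
      obtain ⟨c, hc, e1, e2, e3⟩ := exists_median hT y hp
      have h1 : G.dist y x ≤ G.dist y c + G.dist c x := hT.connected.dist_triangle
      rw [Walk.support_cons, List.mem_cons] at hc
      rcases hc with rfl | hc
      · rw [hdax] at h1
        nlinarith [G.dist_self (v := c)]
      · have h2 := dist_add_dist_of_mem_support hT hq hc
        rw [G.dist_comm (u := c)] at h1
        have hk : G.dist a c = G.dist x c + 1 := by omega
        have hk' : G.dist c b + G.dist x c = n + 1 := by omega
        rw [e1, e2, hk]
        nlinarith [Nat.zero_le (n * G.dist x c)]
    have hlt : ∑ y, (n + 2) * G.dist y x < ∑ y, ((n + 1) * G.dist y a + G.dist y b) :=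
      Finset.sum_lt_sum (fun y _ => conv y) ⟨x, Finset.mem_univ _, by
        rw [dist_self, G.dist_comm (u := x), hdax]; positivity⟩
    rw [Finset.sum_add_distrib, ← Finset.mul_sum, ← Finset.mul_sum] at hlt
    simp only [wcenters, Finset.mem_filter, Finset.mem_univ, true_and] at ha hb
    have h1 := ha x
    have h2 := hb a
    have h3 := ha b
    simp only [weight] at h1 h2 h3
    nlinarith

/-- A tree has at most two weight centers. -/
lemma card_wcenters_le_two {G : SimpleGraph V}
    (hT : G.IsTree) : (wcenters G).card ≤ 2 := by
  by_contra! h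
  obtain ⟨a, ha, b, hb, c, hc, hab, hac, hbc⟩ := Finset.two_lt_card.1 h
  have one : ∀ {x y}, x ∈ wcenters G → y ∈ wcenters G → x ≠ y → G.dist x y = 1 :=
    fun hx hy hxy => le_antisymm (dist_le_one_of_mem_wcenters hT hx hy)
      (hT.connected.pos_dist_of_ne hxy)
  obtain ⟨p, hp⟩ := hT.connected.exists_isPath b c
  obtain ⟨m, -, e1, e2, e3⟩ := exists_median hT a hp
  rw [one ha hb hab] at e1
  rw [one ha hc hac] at e2
  rw [one hb hc hbc] at e3
  omega

lemma wcenters_nonempty {V : Type*} [Fintype V] [Nonempty V] (G : SimpleGraph V) :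
    (wcenters G).Nonempty := by
  obtain ⟨v, -, hv⟩ := Finset.univ.exists_min_image (weight G) Finset.univ_nonempty
  exact ⟨v, by simpa [wcenters] using fun u => hv u (Finset.mem_univ u)⟩

lemma level_le_dist {V : Type*} [Fintype V] {G : SimpleGraph V} {m x : V}
    (hx : x ∈ wcenters G) : level G m ≤ G.dist m x :=
  Nat.sInf_le ⟨x, hx, rfl⟩

/-- A path from `m` to a non-center `c` meeting `k ≥ 1` weight centers has length at least
`level m + k`. -/
lemma level_add_le_length {G : SimpleGraph V}
    {m c : V} {r : G.Walk m c} (hr : r.IsPath) (hc : c ∉ wcenters G)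
    (hk : 1 ≤ (r.support.filter fun x => decide (x ∈ wcenters G)).length) :
    level G m + (r.support.filter fun x => decide (x ∈ wcenters G)).length ≤ r.length := by
  have hcard : (r.support.filter fun x => decide (x ∈ wcenters G)).toFinset.card =
      (r.support.filter fun x => decide (x ∈ wcenters G)).length :=
    List.toFinset_card_of_nodup (hr.support_nodup.filter _)
  have hsub : (r.support.filter fun x => decide (x ∈ wcenters G)).toFinset ⊆
      (Finset.Ico (level G m) r.length).image r.getVert := fun x hx => by
    simp only [List.mem_toFinset, List.mem_filter, decide_eq_true_eq] at hx
    obtain ⟨n, rfl, hn⟩ := Walk.mem_support_iff_exists_getVert.1 hx.1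
    refine Finset.mem_image.2 ⟨n, Finset.mem_Ico.2 ⟨?_, lt_of_le_of_ne hn ?_⟩, rfl⟩
    · refine (level_le_dist hx.2).trans ((dist_le (r.take n)).trans ?_)
      simp
    · rintro rfl
      exact hc (by simpa using hx.2)
  have := (Finset.card_le_card hsub).trans Finset.card_image_le
  rw [Nat.card_Ico] at this
  omega

lemma SameBranch.exists_isPath {V : Type*} [Fintype V] {G : SimpleGraph V} {a b : V}
    (h : SameBranch G a b) :
    ∃ p : G.Walk a b, p.IsPath ∧ ∀ x ∈ p.support, x ∉ wcenters G := by
  obtain ⟨ha, hb, hr⟩ := h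
  obtain ⟨p, hp⟩ := hr.exists_isPath
  let φ : SimpleGraph.induce {x : V | x ∉ wcenters G} G →g G := ⟨Subtype.val, fun h => h⟩
  have hav : ∀ x ∈ (p.map φ).support, x ∉ wcenters G := fun x hx => by
    rw [Walk.support_map] at hx
    obtain ⟨y, -, rfl⟩ := List.mem_map.1 hx
    exact y.2
  exact ⟨p.map φ, hp.map Subtype.val_injective, hav⟩

lemma not_sameBranch {G : SimpleGraph V} {a m : V}
    (h : ∀ p : G.Path a m, (p.1.support.filter fun x => decide (x ∈ wcenters G)).length ≠ 0) :
    ¬ SameBranch G a m := by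
  intro hs
  obtain ⟨p, hp, hav⟩ := hs.exists_isPath
  refine h ⟨p, hp⟩ (List.length_eq_zero_iff.2 (List.filter_eq_nil_iff.2 fun x hx => ?_))
  simpa using hav x hx

/-- In a two-branch tree, two non-centers outside the branch of `m` share a branch. -/
lemma TwoBranch.sameBranch {V : Type*} [Fintype V] {G : SimpleGraph V}
    (h2 : TwoBranch G) {a b m : V} (ha : a ∉ wcenters G) (hb : b ∉ wcenters G)
    (hm : m ∉ wcenters G) (ham : ¬ SameBranch G a m) (hbm : ¬ SameBranch G b m) :
    SameBranch G a b := by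
  let H := SimpleGraph.induce {v : V | v ∉ wcenters G} G
  obtain ⟨x, y, -, hxy⟩ := Nat.card_eq_two_iff.1 h2
  have cov : ∀ C : H.ConnectedComponent, C = x ∨ C = y := fun C => by
    have : C ∈ ({x, y} : Set H.ConnectedComponent) := hxy ▸ Set.mem_univ C
    simpa using this
  have h1 : H.connectedComponentMk ⟨a, ha⟩ ≠ H.connectedComponentMk ⟨m, hm⟩ :=
    fun h => ham ⟨ha, hm, ConnectedComponent.exact h⟩
  have h3 : H.connectedComponentMk ⟨b, hb⟩ ≠ H.connectedComponentMk ⟨m, hm⟩ :=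
    fun h => hbm ⟨hb, hm, ConnectedComponent.exact h⟩
  have h4 : H.connectedComponentMk ⟨a, ha⟩ = H.connectedComponentMk ⟨b, hb⟩ := by
    rcases cov (H.connectedComponentMk ⟨a, ha⟩) with e | e <;>
    rcases cov (H.connectedComponentMk ⟨b, hb⟩) with e' | e' <;>
    rcases cov (H.connectedComponentMk ⟨m, hm⟩) with e'' | e'' <;>
    simp_all
  exact ⟨ha, hb, ConnectedComponent.exact h4⟩

/-- If every path from `m` to `a` or `b` meets exactly `k ≥ 1` weight centers, then the detour
`a, m, b` exceeds `dist a b` by at least `2 * (level m + k)`. -/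
lemma detour_le {G : SimpleGraph V}
    (hT : G.IsTree) (h2 : TwoBranch G) {k : ℕ} (hk : 1 ≤ k) {a b m : V}
    (ha : a ∉ wcenters G) (hb : b ∉ wcenters G) (hm : m ∉ wcenters G)
    (ham : ∀ p : G.Path a m, (p.1.support.filter fun x => decide (x ∈ wcenters G)).length = k)
    (hmb : ∀ p : G.Path m b, (p.1.support.filter fun x => decide (x ∈ wcenters G)).length = k) :
    G.dist a b + 2 * (level G m + k) ≤ G.dist a m + G.dist m b := by
  have hbm : ¬ SameBranch G b m := not_sameBranch fun p => by
    have := hmb p.reverse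
    simp only [Path.reverse_coe, Walk.support_reverse, List.filter_reverse,
      List.length_reverse] at this
    omega
  obtain ⟨p, hp, hav⟩ := (h2.sameBranch ha hb hm
    (not_sameBranch fun p => by rw [ham p]; omega) hbm).exists_isPath
  obtain ⟨c, hc, r, hr, h3, h4⟩ := exists_projection hT m hp
  have hcount := hmb ⟨_, h4⟩
  have hnil : (p.dropUntil c hc).support.tail.filter (fun x => decide (x ∈ wcenters G)) = [] := by
    rw [List.filter_eq_nil_iff]
    intro x hx
    simpa using hav x
      (Walk.support_dropUntil_subset_support _ hc (List.mem_of_mem_tail hx))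
  simp only [Walk.support_append, List.filter_append, hnil, List.append_nil] at hcount
  have hlen := level_add_le_length hr (hav c hc) (by omega)
  have e1 := length_eq_dist_of_isPath hT h3
  have e2 := length_eq_dist_of_isPath hT h4
  have e3 := length_eq_dist_of_isPath hT (hp.takeUntil hc)
  have e4 := length_eq_dist_of_isPath hT (hp.dropUntil hc)
  have e5 := dist_add_dist_of_mem_support hT hp hc
  rw [Walk.length_append] at e1 e2
  rw [Walk.length_reverse] at e1
  rw [G.dist_comm (u := a) (v := m)]
  omega

section InducedOrder

variable {G : SimpleGraph V} {f : V → ℕ} {u : ℕ → V}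

lemma le_label_sub {V : Type*} [Fintype V] {G : SimpleGraph V} {f : V → ℕ} {u : ℕ → V}
    (hf : IsRadioLabelling G f) (hord : IsInducedOrder G f u) {s t : ℕ}
    (hst : s < t) (ht : t < Fintype.card V) :
    (gdiam G : ℤ) + 1 - G.dist (u s) (u t) ≤ (f (u t) : ℤ) - f (u s) := by
  have hlt := hord.2 s t hst ht
  have hne : u t ≠ u s := fun h => by rw [h] at hlt; exact lt_irrefl _ hlt
  have h := hf (u t) (u s) hne
  rw [abs_of_nonneg (by omega), G.dist_comm] at h
  exact h

lemma Jstep_nonneg {V : Type*} [Fintype V] {G : SimpleGraph V} {f : V → ℕ} {u : ℕ → V}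
    (hf : IsRadioLabelling G f) (hord : IsInducedOrder G f u) {t : ℕ}
    (ht : t + 1 < Fintype.card V) : 0 ≤ Jstep G f u t := by
  have := le_label_sub hf hord (Nat.lt_succ_self t) ht
  simp only [Jstep, Nat.succ_eq_add_one] at *
  omega

lemma card_le_Jstep_add_Jstep (hT : G.IsTree) (h2 : TwoBranch G)
    (hf : IsRadioLabelling G f) (hord : IsInducedOrder G f u) {t : ℕ}
    (ht : t + 2 < Fintype.card V) (hrem : u (t + 1) ∈ remote G)
    (h0W : u t ∉ wcenters G) (h1W : u (t + 1) ∉ wcenters G) (h2W : u (t + 2) ∉ wcenters G)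
    (hbr0 : BranchStep G (u t) (u (t + 1))) (hbr1 : BranchStep G (u (t + 1)) (u (t + 2))) :
    ((wcenters G).card : ℤ) ≤ Jstep G f u t + Jstep G f u (t + 1) := by
  have hlab := le_label_sub hf hord (show t < t + 2 by omega) ht
  have : Nonempty V := ⟨u t⟩
  have hpos := (wcenters_nonempty G).card_pos
  have hle := card_wcenters_le_two hT
  simp only [Jstep, add_assoc, one_add_one_eq_two]
  rcases (show (wcenters G).card = 1 ∨ (wcenters G).card = 2 by omega) with hW | hW
  · have := detour_le hT h2 le_rfl h0W h2W h1W (hbr0.1 hW) (hbr1.1 hW)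
    simp only [remote, hW, if_true, Finset.mem_filter, Finset.mem_univ, true_and] at hrem
    omega
  · have := detour_le hT h2 one_le_two h0W h2W h1W (hbr0.2 hW) (hbr1.2 hW)
    simp only [remote, hW, OfNat.ofNat_ne_one, if_false, Finset.mem_filter, Finset.mem_univ,
      true_and] at hrem
    omega

end InducedOrder

/-- **Lemma 6.** -/
theorem stmt12 {V : Type*} [Fintype V] [DecidableEq V] (G : SimpleGraph V)
    (hT : G.IsTree) (hd : 2 ≤ gdiam G) (h2 : TwoBranch G)
    (f : V → ℕ) (hf : IsRadioLabelling G f)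
    (u : ℕ → V) (hord : IsInducedOrder G f u)
    (i j : ℕ) (hi : 0 < i) (hij : i ≤ j) (hj : j < Fintype.card V - 1)
    (hW : ∀ t : ℕ, i ≤ t → t ≤ j → u t ∉ wcenters G)
    (hS : ({u (i-1), u i, u j, u (j+1)} : Finset V) ∩ remote G = {u i, u j})
    (hbr : ∀ t : ℕ, i - 1 ≤ t → t ≤ j → BranchStep G (u t) (u (t+1))) :
    ((((Finset.Icc i j).image u ∩ remote G).card : ℚ)
        - ((({u (i-1), u (j+1)} : Finset V) ∩ wcenters G).card : ℚ))
      / (3 - ((wcenters G).card : ℚ))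
      ≤ (Jseg G f u (i-1) (j+1) : ℚ) := by
  obtain ⟨i, rfl⟩ : ∃ n, i = n + 1 := ⟨i - 1, by omega⟩
  rw [Nat.add_sub_cancel] at hbr ⊢
  set k : ℤ := ((wcenters G).card : ℤ)
  have hnn : ∀ t ∈ Finset.Ico i (j + 1), 0 ≤ Jstep G f u t := fun t ht =>
    Jstep_nonneg hf hord (by have := Finset.mem_Ico.1 ht; omega)
  have hpt : ∀ s ∈ Finset.Ico i j,
      k * ((if u (s + 1) ∈ remote G then 1 else 0) -
        (if s = i then (if u i ∈ wcenters G then 1 else 0) else 0) -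
        (if s = j - 1 then (if u (j + 1) ∈ wcenters G then 1 else 0) else 0)) ≤
      Jstep G f u s + Jstep G f u (s + 1) := fun s hs => by
    rw [Finset.mem_Ico] at hs
    have n0 := hnn s (Finset.mem_Ico.2 (by omega))
    have n1 := hnn (s + 1) (Finset.mem_Ico.2 (by omega))
    have hk0 : 0 ≤ k := Int.natCast_nonneg _
    by_cases hgood : u (s + 1) ∈ remote G ∧ u s ∉ wcenters G ∧ u (s + 2) ∉ wcenters G
    · refine le_trans ?_ (card_le_Jstep_add_Jstep hT h2 hf hord (by omega) hgood.1 hgood.2.1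
        (hW _ (by omega) (by omega)) hgood.2.2 (hbr s (by omega) (by omega))
        (hbr (s + 1) (by omega) (by omega)))
      refine mul_le_of_le_one_right hk0 ?_
      split_ifs <;> omega
    · refine le_trans (mul_nonpos_of_nonneg_of_nonpos hk0 ?_) (add_nonneg n0 n1)
      by_cases hr : u (s + 1) ∈ remote G
      · by_cases hs0 : u s ∈ wcenters G
        · have : s = i := by
            by_contra hne
            exact hW s (by omega) (by omega) hs0
          subst this
          simp only [hr, hs0, if_true]
          split_ifs <;> omega
        · have hs2 : u (s + 2) ∈ wcenters G := by tauto
          have : s = j - 1 := by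
            by_contra hne
            exact hW (s + 2) (by omega) (by omega) hs2
          have hj1 : s + 2 = j + 1 := by omega
          rw [hj1] at hs2
          simp only [hs2, this, if_true]
          split_ifs <;> omega
      · simp only [hr, if_false]
        split_ifs <;> omega
  have hsum := Finset.sum_le_sum hpt
  rw [← Finset.mul_sum, Finset.sum_sub_distrib, Finset.sum_sub_distrib, Finset.sum_ite_eq',
    Finset.sum_ite_eq', if_pos (Finset.mem_Ico.2 (by omega)),
    if_pos (Finset.mem_Ico.2 (by omega)), Finset.sum_add_distrib, Finset.sum_boole] at hsum
  have hJ1 : ∑ s ∈ Finset.Ico i j, Jstep G f u s ≤ Jseg G f u i (j + 1) :=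
    Finset.sum_le_sum_of_subset_of_nonneg (Finset.Ico_subset_Ico_right (by omega))
      fun t ht _ => hnn t ht
  have hJ2 : ∑ s ∈ Finset.Ico i j, Jstep G f u (s + 1) ≤ Jseg G f u i (j + 1) := by
    rw [Finset.sum_Ico_add' (fun t => Jstep G f u t)]
    exact Finset.sum_le_sum_of_subset_of_nonneg (Finset.Ico_subset_Ico_left (by omega))
      fun t ht _ => hnn t ht
  have hcount : ((Finset.Icc (i + 1) j).image u ∩ remote G).card ≤
      ((Finset.Ico i j).filter fun s => u (s + 1) ∈ remote G).card := by
    refine (Finset.card_le_card fun v hv => ?_).trans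
      (Finset.card_image_le (f := fun s => u (s + 1)))
    obtain ⟨hv1, hv2⟩ := Finset.mem_inter.1 hv
    obtain ⟨t, ht, rfl⟩ := Finset.mem_image.1 hv1
    rw [Finset.mem_Icc] at ht
    have ht1 : t - 1 + 1 = t := by omega
    refine Finset.mem_image.2 ⟨t - 1, Finset.mem_filter.2 ⟨Finset.mem_Ico.2 (by omega), ?_⟩, ?_⟩
    · rwa [ht1]
    · simp only [ht1]
  have hends : (if u i ∈ wcenters G then 1 else 0 : ℤ) +
      (if u (j + 1) ∈ wcenters G then 1 else 0) =
      (({u i, u (j + 1)} : Finset V) ∩ wcenters G).card := by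
    have hne : u i ≠ u (j + 1) := fun h => by
      have := hord.2 i (j + 1) (by omega) (by omega)
      rw [h] at this
      exact lt_irrefl _ this
    rw [← Finset.filter_mem_eq_inter, Finset.card_filter, Finset.sum_pair hne]
    push_cast
    rfl
  have hmain : k * ((((Finset.Icc (i + 1) j).image u ∩ remote G).card : ℤ) -
      (({u i, u (j + 1)} : Finset V) ∩ wcenters G).card) ≤ 2 * Jseg G f u i (j + 1) := by
    refine (mul_le_mul_of_nonneg_left ?_ (Int.natCast_nonneg _)).trans
      (hsum.trans (by linarith))
    have : (((Finset.Icc (i + 1) j).image u ∩ remote G).card : ℤ) ≤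
      ((Finset.Ico i j).filter fun s => u (s + 1) ∈ remote G).card := by exact_mod_cast hcount
    linarith
  have hmainQ : ((wcenters G).card : ℚ) *
      ((((Finset.Icc (i + 1) j).image u ∩ remote G).card : ℚ) -
      (({u i, u (j + 1)} : Finset V) ∩ wcenters G).card) ≤ 2 * Jseg G f u i (j + 1) := by
    exact_mod_cast hmain
  have : Nonempty V := ⟨u i⟩
  have hpos := (wcenters_nonempty G).card_pos
  have hle := card_wcenters_le_two hT
  rcases (show (wcenters G).card = 1 ∨ (wcenters G).card = 2 by omega) with hc | hc <;>
  · rw [hc] at hmainQ ⊢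
    rw [div_le_iff₀ (by norm_num)]
    push_cast at hmainQ ⊢
    linarith

end RadioPaper
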